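/- In the linear model of an η-adapted almost-complex structure (see context), the bilinear form g(v, w) := a(v)λ(Jw) − a(Jw)λ(v) + ω(v, Jw) on E is a symmetric, positive-definite bilinear form (an inner product), and J is orthogonal with respect to g, i.e. g(Jv, Jw) = g(v, w) for all v, w ∈ E. (This is the pointwise content of the lemma that the pair (J, g) defines an almost-Hermitian structure on the adapted cylinder ℝ × M.) -/

import Mathlib

/-- In the linear model of an `η`-adapted almost-complex structure, the bilinear form
`g(v, w) := a(v)·λ(Jw) − a(Jw)·λ(v) + ω(v, Jw)` is a symmetric positive-definite bilinear
form, and `J` is orthogonal with respect to `g`. -/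
theorem adapted_almost_complex_structure_gives_inner_product
    {E : Type*} [AddCommGroup E] [Module ℝ E] [FiniteDimensional ℝ E]
    (J : E →ₗ[ℝ] E) (hJJ : ∀ v, J (J v) = -v)
    (pa X : E) (hJpa : J pa = X)
    (a lam : E →ₗ[ℝ] ℝ)
    (ha_pa : a pa = 1) (hlam_X : lam X = 1) (ha_X : a X = 0) (hlam_pa : lam pa = 0)
    (ω : LinearMap.BilinForm ℝ E) (hω_alt : ∀ v, ω v v = 0)
    (hω_pa : ∀ v, ω pa v = 0) (hω_X : ∀ v, ω X v = 0)
    (hsplit : IsCompl (Submodule.span ℝ {pa, X}) (LinearMap.ker a ⊓ LinearMap.ker lam))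
    (hJξ : Submodule.map J (LinearMap.ker a ⊓ LinearMap.ker lam)
      = LinearMap.ker a ⊓ LinearMap.ker lam)
    (hω_J : ∀ v ∈ LinearMap.ker a ⊓ LinearMap.ker lam,
      ∀ w ∈ LinearMap.ker a ⊓ LinearMap.ker lam, ω (J v) (J w) = ω v w)
    (hω_pos : ∀ v ∈ LinearMap.ker a ⊓ LinearMap.ker lam, v ≠ 0 → 0 < ω v (J v))
    (g : E → E → ℝ)
    (hg : ∀ v w, g v w = a v * lam (J w) - a (J w) * lam v + ω v (J w)) :
    (∀ v w, g v w = g w v) ∧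
    (∀ v, v ≠ 0 → 0 < g v v) ∧
    (∀ v w, g (J v) (J w) = g v w) := by
  have hω_anti : ∀ v w, ω v w = -ω w v := fun v w =>
    (LinearMap.IsAlt.neg (B := ω) hω_alt w v).symm
  have hω_pa' : ∀ v, ω v pa = 0 := fun v => by rw [hω_anti, hω_pa, neg_zero]
  have hω_X' : ∀ v, ω v X = 0 := fun v => by rw [hω_anti, hω_X, neg_zero]
  have hJX : J X = -pa := by rw [← hJpa, hJJ]
  have decomp : ∀ v, ∃ u ∈ LinearMap.ker a ⊓ LinearMap.ker lam,
      v = a v • pa + lam v • X + u := fun v =>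
    ⟨v - (a v • pa + lam v • X), by simp [ha_pa, hlam_X, ha_X, hlam_pa], by abel⟩
  have hJu : ∀ u ∈ LinearMap.ker a ⊓ LinearMap.ker lam,
      J u ∈ LinearMap.ker a ⊓ LinearMap.ker lam := fun u hu =>
    hJξ.le (Submodule.mem_map_of_mem hu)
  have haJ : ∀ v, a (J v) = -lam v := fun v => by
    obtain ⟨u, hu, hv⟩ := decomp v
    have hu' : a (J u) = 0 := (hJu u hu).1
    conv_lhs => rw [hv]
    simp [hJpa, hJX, ha_X, ha_pa, hu']
  have hlamJ : ∀ v, lam (J v) = a v := fun v => by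
    obtain ⟨u, hu, hv⟩ := decomp v
    have hu' : lam (J u) = 0 := (hJu u hu).2
    conv_lhs => rw [hv]
    simp [hJpa, hJX, hlam_X, hlam_pa, hu']
  have hωJJ : ∀ v w, ω (J v) (J w) = ω v w := fun v w => by
    obtain ⟨u, hu, hv⟩ := decomp v
    obtain ⟨z, hz, hw⟩ := decomp w
    rw [hv, hw]
    simp [hJpa, hJX, hω_pa, hω_X, hω_pa', hω_X', hω_J u hu z hz]
  have hg' : ∀ v w, g v w = a v * a w + lam v * lam w + ω v (J w) := fun v w => by
    rw [hg, hlamJ, haJ]; ring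
  refine ⟨fun v w => ?_, fun v hv0 => ?_, fun v w => ?_⟩
  · have h : ω v (J w) = ω w (J v) := by
      rw [← hωJJ v (J w), hJJ, map_neg, hω_anti, neg_neg]
    rw [hg', hg', h]; ring
  · obtain ⟨u, hu, hv⟩ := decomp v
    have h : ω v (J v) = ω u (J u) := by
      rw [hv]
      simp [hJpa, hJX, hω_pa, hω_X, hω_pa', hω_X']
    rw [hg', h]
    by_cases hu0 : u = 0
    · have hne : a v ≠ 0 ∨ lam v ≠ 0 := by
        by_contra! hc
        exact hv0 (by rw [hv, hc.1, hc.2, hu0]; simp)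
      rw [hu0, map_zero, map_zero, LinearMap.zero_apply, add_zero]
      rcases hne with hne | hne
      · linarith [mul_self_pos.2 hne, mul_self_nonneg (lam v)]
      · linarith [mul_self_pos.2 hne, mul_self_nonneg (a v)]
    · linarith [hω_pos u hu hu0, mul_self_nonneg (a v), mul_self_nonneg (lam v)]
  · rw [hg', hg', hωJJ, haJ, haJ, hlamJ, hlamJ]; ring
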